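/- Let n ≥ 1. The quadratic forms q : ℤ/n → U(1) form an abelian group under pointwise multiplication, and the evaluation map q ↦ q(1) is an injective group homomorphism whose image is the group of n-th roots of unity if n is odd, and the group of 2n-th roots of unity if n is even. Consequently the group of quadratic forms on ℤ/n with values in U(1) is cyclic of order n if n is odd and cyclic of order 2n if n is even. -/

import Mathlib

/-- The symmetric bicharacter associated to a `U(1)`-valued function on an abelian group. -/
noncomputable def assocBichar {A : Type*} [AddCommGroup A] (q : A → Circle)
    (a b : A) : Circle :=
  q (a + b) * (q a)⁻¹ * (q b)⁻¹

/-- A quadratic form on an abelian group `A` with values in `U(1)`. -/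
def IsQuadraticForm {A : Type*} [AddCommGroup A] (q : A → Circle) : Prop :=
  (∀ (k : ℤ) (a : A), q (k • a) = q a ^ (k ^ 2)) ∧
  (∀ a b c : A, assocBichar q (a + b) c = assocBichar q a c * assocBichar q b c) ∧
  (∀ a b c : A, assocBichar q a (b + c) = assocBichar q a b * assocBichar q a c)

theorem assocBichar_mul {A : Type*} [AddCommGroup A] (p q : A → Circle) (a b : A) :
    assocBichar (p * q) a b = assocBichar p a b * assocBichar q a b := by
  simp only [assocBichar, Pi.mul_apply, mul_inv]
  ac_rfl

theorem assocBichar_inv {A : Type*} [AddCommGroup A] (q : A → Circle) (a b : A) :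
    assocBichar q⁻¹ a b = (assocBichar q a b)⁻¹ := by
  simp only [assocBichar, Pi.inv_apply, mul_inv]

/-- The group of `U(1)`-valued quadratic forms on `A` under pointwise multiplication. -/
def quadraticFormSubgroup (A : Type*) [AddCommGroup A] : Subgroup (A → Circle) where
  carrier := {q | IsQuadraticForm q}
  one_mem' := by simp [IsQuadraticForm, assocBichar]
  mul_mem' := by
    rintro p q ⟨hp, hp₁, hp₂⟩ ⟨hq, hq₁, hq₂⟩
    refine ⟨fun k a => ?_, fun a b c => ?_, fun a b c => ?_⟩
    · simp only [Pi.mul_apply, hp, hq, mul_zpow]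
    · simp only [assocBichar_mul, hp₁, hq₁]
      ac_rfl
    · simp only [assocBichar_mul, hp₂, hq₂]
      ac_rfl
  inv_mem' := by
    rintro q ⟨hq, hq₁, hq₂⟩
    refine ⟨fun k a => ?_, fun a b c => ?_, fun a b c => ?_⟩
    · simp only [Pi.inv_apply, hq, inv_zpow]
    · simp only [assocBichar_inv, hq₁, mul_inv]
    · simp only [assocBichar_inv, hq₂, mul_inv]

namespace IsQuadraticForm

theorem apply_intCast {n : ℕ} {q : ZMod n → Circle} (hq : IsQuadraticForm q) (k : ℤ) :
    q k = q 1 ^ (k ^ 2) := by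
  simpa using hq.1 k 1

theorem ext_one {n : ℕ} {p q : ZMod n → Circle} (hp : IsQuadraticForm p)
    (hq : IsQuadraticForm q) (h : p 1 = q 1) : p = q := by
  funext a
  obtain ⟨k, rfl⟩ := ZMod.intCast_surjective a
  rw [hp.apply_intCast, hq.apply_intCast, h]

theorem apply_one_pow {n : ℕ} {q : ZMod n → Circle} (hq : IsQuadraticForm q) :
    q 1 ^ (if Odd n then n else 2 * n) = 1 := by
  have h₀ : q 0 = 1 := by simpa using hq.apply_intCast 0
  have h₁ : q 1 ^ ((n : ℤ) ^ 2) = 1 := by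
    rw [← hq.apply_intCast n, Int.cast_natCast, ZMod.natCast_self, h₀]
  have h₂ : q 1 ^ (2 * (n : ℤ)) = 1 := by
    have h := hq.apply_intCast (n + 1)
    rw [show ((n : ℤ) + 1) ^ 2 = (n : ℤ) ^ 2 + 2 * n + 1 by ring, zpow_add, zpow_add, h₁,
      zpow_one] at h
    simpa using h
  split_ifs with hn
  · obtain ⟨k, hk⟩ := hn
    have hsq : (n : ℤ) ^ 2 = 2 * n * k + n := by
      rw [hk]
      push_cast
      ring
    rw [hsq, zpow_add, zpow_mul, h₂, one_zpow, one_mul] at h₁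
    exact_mod_cast h₁
  · exact_mod_cast h₂

/-- A root of unity of the appropriate order is the value at `1` of a quadratic form. -/
theorem exists_apply_one_eq {n : ℕ} {c : Circle}
    (hc : c ^ (if Odd n then n else 2 * n) = 1) :
    ∃ q : ZMod n → Circle, IsQuadraticForm q ∧ q 1 = c := by
  have hzpow {m : ℤ} (hm : ((if Odd n then n else 2 * n : ℕ) : ℤ) ∣ m) : c ^ m = 1 := by
    obtain ⟨t, rfl⟩ := hm
    rw [zpow_mul, zpow_natCast, hc, one_zpow]
  have hwell {k l : ℤ} (h : (k : ZMod n) = l) : c ^ (k ^ 2) = c ^ (l ^ 2) := by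
    obtain ⟨t, ht⟩ := (ZMod.intCast_eq_intCast_iff_dvd_sub l k n).1 h.symm
    obtain rfl : k = l + n * t := by linarith
    rw [show (l + n * t) ^ 2 = n * (t * (2 * l + n * t)) + l ^ 2 by ring, zpow_add, hzpow, one_mul]
    split_ifs with hn
    · exact dvd_mul_right _ _
    · obtain ⟨r, hr⟩ := Nat.not_odd_iff_even.1 hn
      refine ⟨t * (l + r * t), ?_⟩
      rw [hr]
      push_cast
      ring
  choose lift hlift using ZMod.intCast_surjective (n := n)
  let q : ZMod n → Circle := fun a => c ^ (lift a ^ 2)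
  have hq (k : ℤ) : q k = c ^ (k ^ 2) := hwell (hlift _)
  have hσ (k l : ℤ) : assocBichar q k l = c ^ (2 * k * l) := by
    rw [assocBichar, ← Int.cast_add, hq, hq, hq, ← zpow_neg, ← zpow_neg, ← zpow_add, ← zpow_add]
    congr 1
    ring
  refine ⟨q, ⟨fun k a => ?_, fun a b d => ?_, fun a b d => ?_⟩, ?_⟩
  · obtain ⟨l, rfl⟩ := ZMod.intCast_surjective a
    rw [zsmul_eq_mul, ← Int.cast_mul, hq, hq, ← zpow_mul]
    congr 1
    ring
  · obtain ⟨k, rfl⟩ := ZMod.intCast_surjective a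
    obtain ⟨l, rfl⟩ := ZMod.intCast_surjective b
    obtain ⟨m, rfl⟩ := ZMod.intCast_surjective d
    rw [← Int.cast_add, hσ, hσ, hσ, ← zpow_add]
    congr 1
    ring
  · obtain ⟨k, rfl⟩ := ZMod.intCast_surjective a
    obtain ⟨l, rfl⟩ := ZMod.intCast_surjective b
    obtain ⟨m, rfl⟩ := ZMod.intCast_surjective d
    rw [← Int.cast_add, hσ, hσ, hσ, ← zpow_add]
    congr 1
    ring
  · simpa using hq 1

end IsQuadraticForm

theorem Circle.exists_isPrimitiveRoot {m : ℕ} (hm : m ≠ 0) :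
    ∃ ζ : Circle, IsPrimitiveRoot ζ m := by
  have h := Complex.isPrimitiveRoot_exp m hm
  refine ⟨⟨_, mem_sphere_zero_iff_norm.2 (h.norm'_eq_one hm)⟩, ?_⟩
  exact IsPrimitiveRoot.of_map_of_injective (f := Circle.coeHom) h Circle.coe_injective

theorem Circle.eq_pow_of_pow_eq_one {m : ℕ} [NeZero m] {ζ c : Circle}
    (hζ : IsPrimitiveRoot ζ m) (hc : c ^ m = 1) : ∃ i : ℕ, ζ ^ i = c := by
  have h := hζ.map_of_injective (f := Circle.coeHom) Circle.coe_injective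
  obtain ⟨i, -, hi⟩ := h.eq_pow_of_pow_eq_one (ξ := (c : ℂ))
    (by rw [← Circle.coe_pow, hc, Circle.coe_one])
  exact ⟨i, Circle.ext (by rw [Circle.coe_pow]; exact hi)⟩

/-- The quadratic forms `ℤ/n → U(1)` form a group under pointwise multiplication;
evaluation at `1` is injective on them, with image the `n`-th roots of unity for `n`
odd and the `2n`-th roots of unity for `n` even; hence the group of quadratic forms
is cyclic of order `n` (n odd) resp. `2n` (n even). -/
theorem quadratic_forms_on_zmod
    (n : ℕ) (hn : 1 ≤ n) :
    ∃ Q : Subgroup (ZMod n → Circle),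
      ((Q : Set (ZMod n → Circle)) = {q | IsQuadraticForm q}) ∧
      Set.InjOn (fun q : ZMod n → Circle => q 1) (Q : Set (ZMod n → Circle)) ∧
      (∀ c : Circle,
        (∃ q ∈ Q, q 1 = c) ↔ c ^ (if Odd n then n else 2 * n) = 1) ∧
      IsCyclic Q ∧
      Nat.card Q = (if Odd n then n else 2 * n) := by
  have hm : (if Odd n then n else 2 * n) ≠ 0 := by split_ifs <;> omega
  have hsurj (c : Circle) :
      (∃ q ∈ quadraticFormSubgroup (ZMod n), q 1 = c) ↔
        c ^ (if Odd n then n else 2 * n) = 1 := by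
    constructor
    · rintro ⟨q, hq, rfl⟩
      exact IsQuadraticForm.apply_one_pow hq
    · exact IsQuadraticForm.exists_apply_one_eq
  have : NeZero (if Odd n then n else 2 * n) := ⟨hm⟩
  obtain ⟨ζ, hζ⟩ := Circle.exists_isPrimitiveRoot hm
  obtain ⟨g, hg, hg₁⟩ := (hsurj ζ).2 hζ.pow_eq_one
  have hgen (q : quadraticFormSubgroup (ZMod n)) :
      q ∈ Subgroup.zpowers (⟨g, hg⟩ : quadraticFormSubgroup (ZMod n)) := by
    obtain ⟨i, hi⟩ :=
      Circle.eq_pow_of_pow_eq_one hζ (IsQuadraticForm.apply_one_pow q.2)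
    refine ⟨i, Subtype.ext (IsQuadraticForm.ext_one (Subtype.prop _) q.2 ?_)⟩
    simp [hg₁, hi]
  let evalOne : quadraticFormSubgroup (ZMod n) →* Circle :=
    (Pi.evalMonoidHom (fun _ : ZMod n => Circle) 1).comp (Subgroup.subtype _)
  have evalOne_injective : Function.Injective evalOne := fun p q h =>
    Subtype.ext (IsQuadraticForm.ext_one p.2 q.2 h)
  refine ⟨quadraticFormSubgroup (ZMod n), rfl,
    fun p hp q hq h => IsQuadraticForm.ext_one hp hq h, hsurj, ⟨⟨g, hg⟩, hgen⟩, ?_⟩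
  rw [← orderOf_eq_card_of_forall_mem_zpowers hgen, ← orderOf_injective evalOne evalOne_injective,
    hζ.eq_orderOf]
  exact congrArg orderOf hg₁
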